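/- Let Γ be an arbitrary set, let X = c₀(Γ) with its supremum norm, let Ω be an open subset of X, and let u₀ : cl(Ω) → ℝ be a Lipschitz function such that lip(u₀, ∂Ω) < lip(u₀, cl(Ω)). Then for every ε > 0 there exists a function v : cl(Ω) → ℝ such that v is of class C^∞ on Ω, v is Lipschitz on cl(Ω) with lip(v, cl(Ω)) ≤ lip(u₀, cl(Ω)), v = u₀ on ∂Ω, and |u₀ − v| ≤ ε on cl(Ω). -/

import Mathlib

open Metric Set MeasureTheory

/-- `lipOn f s` is the Lipschitz constant of `f` on `s`:
the infimum of all `L > 0` such that `|f x - f y| ≤ L * dist x y` for all `x, y ∈ s`. -/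
noncomputable def lipOn {X : Type*} [PseudoMetricSpace X] (f : X → ℝ) (s : Set X) : ℝ :=
  sInf {L : ℝ | 0 < L ∧ ∀ x ∈ s, ∀ y ∈ s, |f x - f y| ≤ L * dist x y}

/-- `f` is `K`-Lipschitz on `s`. -/
def IsLipschitzWithOn {X : Type*} [PseudoMetricSpace X] (K : ℝ) (f : X → ℝ) (s : Set X) : Prop :=
  ∀ x ∈ s, ∀ y ∈ s, |f x - f y| ≤ K * dist x y
open scoped ZeroAtInfty

section SmoothApproximation

open scoped ContDiff NNReal ENNReal Topology
open Filter

/-- The soft threshold function, which shifts every real number towards `0` by at most `r`. -/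
noncomputable def softThreshold (r s : ℝ) : ℝ := s - max (-r) (min r s)

lemma softThreshold_eq_zero {r s : ℝ} (h : |s| ≤ r) : softThreshold r s = 0 := by
  rw [abs_le] at h
  simp [softThreshold, h.1, h.2]

lemma abs_softThreshold_sub_self_le {r : ℝ} (hr : 0 ≤ r) (s : ℝ) :
    |softThreshold r s - s| ≤ r := by
  have h1 : max (-r) (min r s) ≤ r := max_le (by linarith) (min_le_left _ _)
  have h2 : -r ≤ max (-r) (min r s) := le_max_left _ _
  rw [softThreshold, abs_le]
  constructor <;> linarith

lemma abs_softThreshold_sub_le (r s t : ℝ) :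
    |softThreshold r s - softThreshold r t| ≤ |s - t| := by
  unfold softThreshold
  grind

lemma continuous_softThreshold (r : ℝ) : Continuous (softThreshold r) := by
  unfold softThreshold
  fun_prop

namespace ZeroAtInftyContinuousMap

variable {Γ : Type*} [TopologicalSpace Γ]

lemma abs_sub_apply_le_dist (x y : C₀(Γ, ℝ)) (γ : Γ) : |x γ - y γ| ≤ dist x y := by
  rw [← dist_toBCF_eq_dist]
  exact BoundedContinuousFunction.dist_coe_le_dist (f := x.toBCF) (g := y.toBCF) γ

lemma dist_le_of_forall {x y : C₀(Γ, ℝ)} {c : ℝ} (hc : 0 ≤ c) (h : ∀ γ, |x γ - y γ| ≤ c) :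
    dist x y ≤ c := by
  rw [← dist_toBCF_eq_dist]
  exact (BoundedContinuousFunction.dist_le hc).2 h

/-- The restriction to a finite set of coordinates. -/
noncomputable def restrictFinset (F : Finset Γ) : C₀(Γ, ℝ) →L[ℝ] (F → ℝ) :=
  ContinuousLinearMap.pi fun i =>
    LinearMap.mkContinuous
      { toFun := fun x : C₀(Γ, ℝ) => x i
        map_add' := fun _ _ => rfl
        map_smul' := fun _ _ => rfl } 1 fun x => by
      simpa using abs_sub_apply_le_dist x 0 i

@[simp] lemma restrictFinset_apply (F : Finset Γ) (x : C₀(Γ, ℝ)) (i : F) :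
    restrictFinset F x i = x i := rfl

variable [DiscreteTopology Γ]

lemma tendsto_zero_of_finite_support {g : Γ → ℝ} (h : {γ | g γ ≠ 0}.Finite) :
    Tendsto g (cocompact Γ) (𝓝 0) := by
  rw [cocompact_eq_cofinite]
  refine tendsto_const_nhds.congr' ?_
  filter_upwards [h.compl_mem_cofinite] with γ hγ
  simpa [eq_comm] using hγ

lemma finite_le_abs (x : C₀(Γ, ℝ)) {a : ℝ} (ha : 0 < a) : {γ | a ≤ |x γ|}.Finite := by
  have h := x.zero_at_infty'
  rw [cocompact_eq_cofinite] at h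
  have := h.eventually (Metric.ball_mem_nhds 0 ha)
  rw [eventually_cofinite] at this
  refine this.subset fun γ hγ => ?_
  simpa using hγ

/-- The extension by zero of a function on a finite set of coordinates. -/
noncomputable def ofFinset (F : Finset Γ) (s : F → ℝ) : C₀(Γ, ℝ) where
  toFun := Function.extend Subtype.val s 0
  continuous_toFun := continuous_of_discreteTopology
  zero_at_infty' := tendsto_zero_of_finite_support <| F.finite_toSet.subset fun γ hγ => by
    by_contra h
    refine hγ (Function.extend_apply' _ _ _ ?_)
    rintro ⟨i, rfl⟩
    exact h i.2

lemma ofFinset_apply_of_mem {F : Finset Γ} (s : F → ℝ) {γ : Γ} (h : γ ∈ F) :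
    ofFinset F s γ = s ⟨γ, h⟩ :=
  Subtype.val_injective.extend_apply s 0 (⟨γ, h⟩ : F)

lemma ofFinset_apply_of_notMem {F : Finset Γ} (s : F → ℝ) {γ : Γ} (h : γ ∉ F) :
    ofFinset F s γ = 0 :=
  Function.extend_apply' _ _ _ (by rintro ⟨i, rfl⟩; exact h i.2)

lemma continuous_ofFinset (F : Finset Γ) : Continuous (ofFinset F) := by
  refine (LipschitzWith.of_dist_le_mul (K := 1) fun s t => ?_).continuous
  refine dist_le_of_forall (by positivity) fun γ => ?_
  by_cases h : γ ∈ F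
  · rw [ofFinset_apply_of_mem _ h, ofFinset_apply_of_mem _ h]
    simpa [Real.dist_eq] using dist_le_pi_dist s t ⟨γ, h⟩
  · rw [ofFinset_apply_of_notMem _ h, ofFinset_apply_of_notMem _ h]
    simp

/-- Shift the coordinates of `x` by `-t`, truncated at level `a`, and then apply the soft threshold
at level `2 * a`, so that only finitely many coordinates survive. -/
noncomputable def shiftThreshold {a : ℝ} (ha : 0 < a) (x : C₀(Γ, ℝ)) (t : Γ → ℝ) : C₀(Γ, ℝ) where
  toFun γ := softThreshold (2 * a) (x γ - max (-a) (min a (t γ)))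
  continuous_toFun := continuous_of_discreteTopology
  zero_at_infty' := tendsto_zero_of_finite_support <| (finite_le_abs x ha).subset fun γ hγ => by
    by_contra h
    refine hγ (softThreshold_eq_zero ?_)
    simp only [mem_ofPred_eq, not_le] at h
    grind

lemma shiftThreshold_apply {a : ℝ} (ha : 0 < a) (x : C₀(Γ, ℝ)) (t : Γ → ℝ) (γ : Γ) :
    shiftThreshold ha x t γ = softThreshold (2 * a) (x γ - max (-a) (min a (t γ))) := rfl

lemma dist_shiftThreshold_le {a : ℝ} (ha : 0 < a) (x : C₀(Γ, ℝ)) (t : Γ → ℝ) :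
    dist (shiftThreshold ha x t) x ≤ 3 * a := by
  refine dist_le_of_forall (by positivity) fun γ => ?_
  have h := abs_softThreshold_sub_self_le (r := 2 * a) (by positivity)
    (x γ - max (-a) (min a (t γ)))
  rw [shiftThreshold_apply]
  grind

lemma dist_shiftThreshold_shiftThreshold_le {a : ℝ} (ha : 0 < a) (x y : C₀(Γ, ℝ)) (t : Γ → ℝ) :
    dist (shiftThreshold ha x t) (shiftThreshold ha y t) ≤ dist x y := by
  refine dist_le_of_forall dist_nonneg fun γ => ?_
  refine (abs_softThreshold_sub_le _ _ _).trans ?_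
  simpa using abs_sub_apply_le_dist x y γ

lemma shiftThreshold_eq_ofFinset {a : ℝ} (ha : 0 < a) {x : C₀(Γ, ℝ)} {F : Finset Γ}
    (hF : ∀ γ, γ ∉ F → |x γ| ≤ a) (t : Γ → ℝ) :
    shiftThreshold ha x t = ofFinset F fun i =>
      softThreshold (2 * a) (restrictFinset F x i - max (-a) (min a (F.restrict t i))) := by
  ext γ
  by_cases h : γ ∈ F
  · rw [ofFinset_apply_of_mem _ h]
    rfl
  · rw [ofFinset_apply_of_notMem _ h, shiftThreshold_apply]
    have := hF γ h
    exact softThreshold_eq_zero (by grind)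

lemma exists_finset_eventually (x : C₀(Γ, ℝ)) {a : ℝ} (ha : 0 < a) :
    ∃ F : Finset Γ, ∀ᶠ y in 𝓝 x, ∀ γ, γ ∉ F → |y γ| ≤ a := by
  refine ⟨(finite_le_abs x (half_pos ha)).toFinset, ?_⟩
  filter_upwards [Metric.ball_mem_nhds x (half_pos ha)] with y hy γ hγ
  have h1 := abs_sub_apply_le_dist y x γ
  have h2 : dist y x < a / 2 := hy
  simp only [Finite.mem_toFinset, mem_ofPred_eq, not_le] at hγ
  grind

end ZeroAtInftyContinuousMap

lemma MeasureTheory.Measure.pi_withDensity_ofReal {ι : Type*} [Fintype ι] {ρ : ℝ → ℝ}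
    (hρ : Integrable ρ) (h0 : ∀ s, 0 ≤ ρ s)
    [SigmaFinite ((volume : Measure ℝ).withDensity fun s => ENNReal.ofReal (ρ s))] :
    Measure.pi (fun _ : ι => (volume : Measure ℝ).withDensity fun s => ENNReal.ofReal (ρ s)) =
      (volume : Measure (ι → ℝ)).withDensity fun t => ENNReal.ofReal (∏ i, ρ (t i)) := by
  refine Measure.pi_eq fun s hs => ?_
  have key : ∀ t : ι → ℝ, (pi univ s).indicator (fun t => ENNReal.ofReal (∏ i, ρ (t i))) t =
      ENNReal.ofReal (∏ i, (s i).indicator ρ (t i)) := by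
    intro t
    by_cases ht : t ∈ pi univ s
    · rw [indicator_of_mem ht]
      congr 1
      exact Finset.prod_congr rfl fun i _ => (indicator_of_mem (ht i trivial) _).symm
    · rw [indicator_of_notMem ht]
      simp only [Set.mem_pi, mem_univ, true_implies, not_forall] at ht
      obtain ⟨i, hi⟩ := ht
      rw [Finset.prod_eq_zero (Finset.mem_univ i) (indicator_of_notMem hi _), ENNReal.ofReal_zero]
  have hn : ∀ i r, 0 ≤ (s i).indicator ρ r := fun i => indicator_nonneg fun r _ => h0 r
  rw [withDensity_apply _ (MeasurableSet.univ_pi hs),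
    ← lintegral_indicator (MeasurableSet.univ_pi hs), lintegral_congr key,
    ← ofReal_integral_eq_lintegral_ofReal, integral_fintype_prod_volume_eq_prod,
    ENNReal.ofReal_prod_of_nonneg]
  · refine Finset.prod_congr rfl fun i _ => ?_
    rw [withDensity_apply _ (hs i), ← ofReal_integral_eq_lintegral_ofReal hρ.integrableOn
      (ae_of_all _ h0), integral_indicator (hs i)]
  · exact fun i _ => integral_nonneg (hn i)
  · exact Integrable.fintype_prod fun i => hρ.indicator (hs i)
  · exact ae_of_all _ fun t => Finset.prod_nonneg fun i _ => hn i _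

/-- The probability measure on `ℝ` whose density is a normed bump function. -/
noncomputable def bumpMeasure (ρ : ContDiffBump (0 : ℝ)) : Measure ℝ :=
  volume.withDensity fun s => ENNReal.ofReal (ρ.normed volume s)

instance (ρ : ContDiffBump (0 : ℝ)) : IsProbabilityMeasure (bumpMeasure ρ) := by
  constructor
  rw [bumpMeasure, withDensity_apply _ MeasurableSet.univ, Measure.restrict_univ,
    ← ofReal_integral_eq_lintegral_ofReal ρ.integrable_normed
      (ae_of_all _ fun s => ρ.nonneg_normed s), ρ.integral_normed, ENNReal.ofReal_one]

lemma contDiff_integral_pi_bumpMeasure {ι : Type*} [Fintype ι] (ρ : ContDiffBump (0 : ℝ))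
    {H : (ι → ℝ) → ℝ} (hH : Continuous H) :
    ContDiff ℝ ∞ fun s : ι → ℝ =>
      ∫ t, H (fun i => s i - max (-ρ.rOut) (min ρ.rOut (t i)))
        ∂Measure.pi fun _ : ι => bumpMeasure ρ := by
  set p : (ι → ℝ) → ℝ := fun t => ∏ i, ρ.normed volume (t i) with hp
  have hp0 : ∀ t, 0 ≤ p t := fun t => Finset.prod_nonneg fun i _ => ρ.nonneg_normed _
  have hpc : ContDiff ℝ ∞ p := contDiff_prod fun i _ => ρ.contDiff_normed.comp (contDiff_apply ℝ ℝ i)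
  have hsupp : ∀ t, p t ≠ 0 → ∀ i, |t i| < ρ.rOut := by
    intro t ht i
    have h := Finset.prod_ne_zero_iff.1 ht i (Finset.mem_univ i)
    have h' : t i ∈ Function.support (ρ.normed volume) := h
    rw [ρ.support_normed_eq] at h'
    simpa using h'
  have hcs : HasCompactSupport p := by
    refine HasCompactSupport.of_support_subset_isCompact
      (isCompact_closedBall (0 : ι → ℝ) ρ.rOut) fun t ht => ?_
    rw [mem_closedBall_zero_iff, pi_norm_le_iff_of_nonneg ρ.rOut_pos.le]
    exact fun i => (hsupp t ht i).le
  have := hcs.contDiff_convolution_left (μ := volume) (ContinuousLinearMap.lsmul ℝ ℝ) hpc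
    (hH.locallyIntegrable (μ := volume))
  convert this using 2 with s
  have hsf : SigmaFinite ((volume : Measure ℝ).withDensity
      fun s => ENNReal.ofReal (ρ.normed volume s)) :=
    inferInstanceAs (SigmaFinite (bumpMeasure ρ))
  rw [convolution_def]
  simp only [bumpMeasure]
  rw [Measure.pi_withDensity_ofReal ρ.integrable_normed ρ.nonneg_normed,
    integral_withDensity_eq_integral_toReal_smul hpc.continuous.measurable.ennreal_ofReal (by simp)]
  refine integral_congr_ae (ae_of_all _ fun t => ?_)
  simp only [ContinuousLinearMap.lsmul_apply, smul_eq_mul]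
  rw [ENNReal.toReal_ofReal (hp0 t)]
  by_cases ht : p t = 0
  · rw [ht, zero_mul, zero_mul]
  · congr 2
    ext i
    have := abs_lt.1 (hsupp t ht i)
    simp [this.1.le, this.2.le]

namespace ZeroAtInftyContinuousMap

variable {Γ : Type*} [TopologicalSpace Γ] [DiscreteTopology Γ]

/-- Lipschitz functions on `c₀(Γ)` have smooth local averages with the same Lipschitz constant. -/
lemma exists_contDiff_average {K : ℝ≥0} {f : C₀(Γ, ℝ) → ℝ} (hf : LipschitzWith K f)
    {δ : ℝ} (hδ : 0 < δ) :
    ∃ g : C₀(Γ, ℝ) → ℝ, ContDiff ℝ ∞ g ∧ LipschitzWith K g ∧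
      (∀ x c, (∀ y, dist y x ≤ δ → f y ≤ c) → g x ≤ c) ∧
      ∀ x c, (∀ y, dist y x ≤ δ → c ≤ f y) → c ≤ g x := by
  obtain ⟨a, ha, ha'⟩ : ∃ a : ℝ, 0 < a ∧ 3 * a = δ := ⟨δ / 3, by positivity, by ring⟩
  let ρ : ContDiffBump (0 : ℝ) := ⟨a / 2, a, by positivity, by linarith⟩
  let μ : Measure (Γ → ℝ) := Measure.infinitePi fun _ => bumpMeasure ρ
  let H : Finset Γ → C₀(Γ, ℝ) → ℝ := fun F x => ∫ t, f (ofFinset F fun i =>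
      softThreshold (2 * a) (restrictFinset F x i - max (-a) (min a (t i))))
        ∂Measure.pi fun _ : F => bumpMeasure ρ
  have hcont : ∀ F : Finset Γ, Continuous fun s : F → ℝ =>
      f (ofFinset F fun i => softThreshold (2 * a) (s i)) := fun F =>
    hf.continuous.comp ((continuous_ofFinset F).comp
      (continuous_pi fun i => (continuous_softThreshold _).comp (continuous_apply i)))
  have hH : ∀ F, ContDiff ℝ ∞ (H F) := fun F =>
    (contDiff_integral_pi_bumpMeasure ρ (hcont F)).comp (restrictFinset F).contDiff
  have hint : ∀ x, Integrable (fun t => f (shiftThreshold ha x t)) μ := by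
    intro x
    obtain ⟨F, hF⟩ := exists_finset_eventually x ha
    have heq := shiftThreshold_eq_ofFinset ha hF.self_of_nhds
    refine Integrable.of_bound (C := |f x| + K * (3 * a)) ?_ (ae_of_all _ fun t => ?_)
    · simp_rw [heq]
      have h1 : Continuous fun t : F → ℝ => f (ofFinset F fun i =>
          softThreshold (2 * a) (restrictFinset F x i - max (-a) (min a (t i)))) :=
        (hcont F).comp (f := fun (t : F → ℝ) i => restrictFinset F x i - max (-a) (min a (t i)))
          (by fun_prop)
      exact (h1.measurable.comp (Finset.measurable_restrict F)).aestronglyMeasurable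
    · have h1 := hf.dist_le_mul (shiftThreshold ha x t) x
      have h2 : K * dist (shiftThreshold ha x t) x ≤ K * (3 * a) := by
        gcongr
        exact dist_shiftThreshold_le ha x t
      rw [Real.dist_eq] at h1
      rw [Real.norm_eq_abs]
      have h3 := abs_sub_abs_le_abs_sub (f (shiftThreshold ha x t)) (f x)
      linarith
  refine ⟨fun x => ∫ t, f (shiftThreshold ha x t) ∂μ, ?_, ?_, ?_, ?_⟩
  · rw [contDiff_iff_contDiffAt]
    intro x
    obtain ⟨F, hF⟩ := exists_finset_eventually x ha
    refine (hH F).contDiffAt.congr_of_eventuallyEq ?_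
    filter_upwards [hF] with y hy
    simp_rw [shiftThreshold_eq_ofFinset ha hy]
    refine integral_restrict_infinitePi (μ := fun _ : Γ => bumpMeasure ρ)
      (f := fun t : F → ℝ => f (ofFinset F fun i =>
        softThreshold (2 * a) (restrictFinset F y i - max (-a) (min a (t i))))) ?_
    exact Continuous.aestronglyMeasurable <|
      (hcont F).comp (f := fun (t : F → ℝ) i => restrictFinset F y i - max (-a) (min a (t i)))
        (by fun_prop)
  · refine LipschitzWith.of_dist_le_mul fun x y => ?_
    rw [dist_eq_norm, ← integral_sub (hint x) (hint y)]
    refine (norm_integral_le_of_norm_le_const (C := K * dist x y) (ae_of_all _ fun t => ?_)).trans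
      (by simp)
    rw [← dist_eq_norm]
    refine (hf.dist_le_mul _ _).trans ?_
    gcongr
    exact dist_shiftThreshold_shiftThreshold_le ha x y t
  · intro x c h
    have := integral_mono (hint x) (integrable_const c) fun t =>
      h _ (ha' ▸ dist_shiftThreshold_le ha x t)
    simpa using this
  · intro x c h
    have := integral_mono (integrable_const c) (hint x) fun t =>
      h _ (ha' ▸ dist_shiftThreshold_le ha x t)
    simpa using this

lemma exists_contDiff_approx {K : ℝ≥0} {f : C₀(Γ, ℝ) → ℝ} (hf : LipschitzWith K f)
    {ε : ℝ} (hε : 0 < ε) :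
    ∃ g : C₀(Γ, ℝ) → ℝ, ContDiff ℝ ∞ g ∧ LipschitzWith K g ∧ ∀ x, |g x - f x| ≤ ε := by
  obtain ⟨g, hg, hgK, hle, hge⟩ :=
    exists_contDiff_average hf (δ := ε / (K + 1)) (by positivity)
  have key : ∀ x y, dist y x ≤ ε / (K + 1) → |f y - f x| ≤ ε := by
    intro x y hxy
    have h1 : (K : ℝ) * (ε / (K + 1)) ≤ ε := by
      rw [mul_div_assoc', div_le_iff₀ (by positivity)]
      nlinarith
    calc |f y - f x| ≤ K * dist y x := hf.dist_le_mul y x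
      _ ≤ K * (ε / (K + 1)) := by gcongr
      _ ≤ ε := h1
  refine ⟨g, hg, hgK, fun x => abs_le.2 ⟨?_, ?_⟩⟩
  · have := hge x (f x - ε) fun y hy => by linarith [(abs_le.1 (key x y hy)).1]
    linarith
  · have := hle x (f x + ε) fun y hy => by linarith [(abs_le.1 (key x y hy)).2]
    linarith

end ZeroAtInftyContinuousMap

lemma exists_contDiff_ramp {η : ℝ} (hη : 0 < η) :
    ∃ m : ℝ → ℝ, ContDiff ℝ ∞ m ∧ (∀ r ≤ 0, m r = 0) ∧
      (∀ a b, a ≤ b → 0 ≤ m b - m a ∧ m b - m a ≤ b - a) ∧ ∀ r, r - η ≤ m r := by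
  let σ : ℝ → ℝ := fun s => Real.smoothTransition (s / η)
  have hσ : ContDiff ℝ ∞ σ := Real.smoothTransition.contDiff.comp (contDiff_id.div_const η)
  have hi : ∀ a b, IntervalIntegrable σ volume a b := hσ.continuous.intervalIntegrable
  have hsub : ∀ a b, (∫ s in (0 : ℝ)..b, σ s) - ∫ s in (0 : ℝ)..a, σ s = ∫ s in a..b, σ s :=
    fun a b => intervalIntegral.integral_interval_sub_left (hi _ _) (hi _ _)
  have hinc : ∀ a b, a ≤ b → 0 ≤ (∫ s in (0 : ℝ)..b, σ s) - (∫ s in (0 : ℝ)..a, σ s) ∧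
      (∫ s in (0 : ℝ)..b, σ s) - (∫ s in (0 : ℝ)..a, σ s) ≤ b - a := by
    intro a b hab
    rw [hsub]
    refine ⟨intervalIntegral.integral_nonneg hab fun s _ => Real.smoothTransition.nonneg _, ?_⟩
    have := intervalIntegral.integral_mono_on hab (hi a b) (intervalIntegrable_const (c := (1 : ℝ)))
      fun s _ => Real.smoothTransition.le_one _
    simpa using this
  have hzero : ∀ r ≤ 0, ∫ s in (0 : ℝ)..r, σ s = 0 := by
    intro r hr
    rw [intervalIntegral.integral_congr (g := fun _ => (0 : ℝ)), intervalIntegral.integral_zero]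
    intro s hs
    rw [uIcc_of_ge hr] at hs
    exact Real.smoothTransition.zero_of_nonpos (div_nonpos_of_nonpos_of_nonneg hs.2 hη.le)
  refine ⟨fun r => ∫ s in (0 : ℝ)..r, σ s, ?_, hzero, hinc, ?_⟩
  · have hd : ∀ r, HasDerivAt (fun r => ∫ s in (0 : ℝ)..r, σ s) (σ r) r := fun r =>
      intervalIntegral.integral_hasDerivAt_right (hi _ _)
        hσ.continuous.stronglyMeasurable.stronglyMeasurableAtFilter hσ.continuous.continuousAt
    rw [contDiff_infty_iff_deriv]
    exact ⟨fun r => (hd r).differentiableAt, by rwa [funext fun r => (hd r).deriv]⟩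
  · intro r
    have h0 : ∫ s in (0 : ℝ)..0, σ s = 0 := hzero 0 le_rfl
    rcases le_total r 0 with hr | hr
    · simp only [hzero r hr]
      linarith
    rcases le_total r η with hr' | hr'
    · have := (hinc 0 r hr).1
      linarith
    · have h1 := (hinc 0 η hη.le).1
      have h2 := hsub η r
      rw [intervalIntegral.integral_congr (a := η) (g := fun _ => (1 : ℝ)),
        intervalIntegral.integral_const, smul_eq_mul] at h2
      · simp only
        linarith
      · intro s hs
        rw [uIcc_of_le hr'] at hs
        exact Real.smoothTransition.one_of_one_le ((one_le_div hη).2 hs.1)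

lemma LipschitzWith.add_ramp_sub {X : Type*} [PseudoMetricSpace X] {K : ℝ≥0} {m : ℝ → ℝ}
    (hm : ∀ a b, a ≤ b → 0 ≤ m b - m a ∧ m b - m a ≤ b - a) {y z : X → ℝ}
    (hy : LipschitzWith K y) (hz : LipschitzWith K z) :
    LipschitzWith K fun x => y x + m (z x - y x) := by
  refine LipschitzWith.of_dist_le_mul fun p q => ?_
  have h1 := hy.dist_le_mul p q
  have h2 := hz.dist_le_mul p q
  rw [Real.dist_eq, abs_le] at *
  rcases le_total (z p - y p) (z q - y q) with h | h
  · have := hm _ _ h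
    constructor <;> linarith
  · have := hm _ _ h
    constructor <;> linarith

/-- A smooth function close to `A` that agrees with `V` where `V` is close to `A`. -/
lemma exists_contDiffOn_clamp {X : Type*} [NormedAddCommGroup X] [NormedSpace ℝ X] {K : ℝ≥0}
    {A V : X → ℝ} {Ω : Set X} (hA : LipschitzWith K A) (hV : LipschitzWith K V)
    (hAs : ContDiffOn ℝ ∞ A Ω) (hVs : ContDiffOn ℝ ∞ V Ω) {ε η : ℝ} (hε : 0 < ε) (hη : 0 < η) :
    ∃ v : X → ℝ, LipschitzWith K v ∧ ContDiffOn ℝ ∞ v Ω ∧ (∀ x, |v x - A x| ≤ ε + η) ∧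
      ∀ x, |V x - A x| ≤ ε → v x = V x := by
  obtain ⟨m, hms, hm0, hminc, hmge⟩ := exists_contDiff_ramp hη
  have hmle : ∀ r, m r ≤ max r 0 := by
    intro r
    rcases le_total r 0 with h | h
    · rw [hm0 r h]
      exact le_max_right _ _
    · have := (hminc 0 r h).2
      rw [hm0 0 le_rfl] at this
      exact le_max_of_le_left (by linarith)
  have hAc : ∀ c : ℝ, LipschitzWith K fun x => A x + c := fun c =>
    LipschitzWith.of_dist_le_mul fun p q => by simpa using hA.dist_le_mul p q
  let W : X → ℝ := fun x => V x - m (V x - (A x + ε))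
  have hW : LipschitzWith K W := by
    have h := LipschitzWith.add_ramp_sub (m := fun r => -m (-r)) (fun a b hab => by
      have := hminc (-b) (-a) (by linarith)
      constructor <;> linarith) hV (hAc ε)
    have e : W = fun x => V x + -m (-(A x + ε - V x)) := by
      funext x
      simp only [W, neg_sub]
      ring
    rwa [e]
  have hWs : ContDiffOn ℝ ∞ W Ω := hVs.sub (hms.comp_contDiffOn (hVs.sub (hAs.add contDiffOn_const)))
  refine ⟨fun x => W x + m (A x + -ε - W x), LipschitzWith.add_ramp_sub hminc hW (hAc (-ε)),
    hWs.add (hms.comp_contDiffOn ((hAs.add contDiffOn_const).sub hWs)), fun x => ?_, fun x hx => ?_⟩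
  · have h1 := hmge (V x - (A x + ε))
    have h2 := hmge (A x + -ε - W x)
    have h3 := hmle (A x + -ε - W x)
    have h4 : W x ≤ A x + ε + η := by
      simp only [W]
      linarith
    rw [abs_le]
    constructor
    · linarith
    · rcases max_cases (A x + -ε - W x) 0 with h | h <;> linarith
  · dsimp only
    rw [abs_le] at hx
    have hWV : W x = V x := by
      simp only [W]
      rw [hm0 _ (by linarith), sub_zero]
    rw [hWV, hm0 _ (by linarith), add_zero]

namespace ZeroAtInftyContinuousMap

variable {Γ : Type*} [TopologicalSpace Γ] [DiscreteTopology Γ]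

lemma exists_contDiff_cutoff (S : Set C₀(Γ, ℝ)) {b : ℝ} (hb : 0 < b) :
    ∃ χ : C₀(Γ, ℝ) → ℝ, ∃ L : ℝ≥0, ContDiff ℝ ∞ χ ∧ LipschitzWith L χ ∧
      (∀ x, 0 ≤ χ x) ∧ (∀ x, χ x ≤ 1) ∧ (∀ x, b ≤ infDist x S → χ x = 1) ∧
      ∀ x, infDist x S ≤ b / 2 → χ x = 0 := by
  let f : C₀(Γ, ℝ) → ℝ := fun x => max 0 (min 1 (4 / b * (infDist x S - 5 / 8 * b)))
  have hf : LipschitzWith (Real.toNNReal (4 / b)) f := by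
    refine LipschitzWith.of_dist_le_mul fun x y => ?_
    have hcl : ∀ p q : ℝ, |max 0 (min 1 p) - max 0 (min 1 q)| ≤ |p - q| := by
      intro p q
      grind
    rw [Real.dist_eq, Real.coe_toNNReal _ (by positivity)]
    refine (hcl _ _).trans ?_
    rw [← mul_sub, abs_mul, abs_of_pos (by positivity : 0 < 4 / b), sub_sub_sub_cancel_right,
      ← Real.dist_eq]
    gcongr
    simpa using (lipschitz_infDist_pt S).dist_le_mul x y
  have hdist : ∀ x y : C₀(Γ, ℝ), dist y x ≤ b / 8 → |infDist y S - infDist x S| ≤ b / 8 := by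
    intro x y hxy
    have := (lipschitz_infDist_pt S).dist_le_mul y x
    rw [Real.dist_eq, NNReal.coe_one, one_mul] at this
    linarith
  obtain ⟨g, hg, hgL, hle, hge⟩ := exists_contDiff_average hf (δ := b / 8) (by positivity)
  have h0 : ∀ x, 0 ≤ g x := fun x => hge x 0 fun y _ => le_max_left _ _
  have h1 : ∀ x, g x ≤ 1 := fun x => hle x 1 fun y _ => max_le zero_le_one (min_le_left _ _)
  refine ⟨g, _, hg, hgL, h0, h1, fun x hx => le_antisymm (h1 x) (hge x 1 fun y hy => ?_),
    fun x hx => le_antisymm (hle x 0 fun y hy => ?_) (h0 x)⟩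
  · have h := (abs_le.1 (hdist x y hy)).1
    refine le_max_of_le_right (le_min le_rfl ?_)
    rw [div_mul_eq_mul_div, le_div_iff₀ hb]
    linarith
  · have h := (abs_le.1 (hdist x y hy)).2
    refine max_le le_rfl ((min_le_right _ _).trans ?_)
    exact mul_nonpos_of_nonneg_of_nonpos (by positivity) (by linarith)

/-- An increasing sequence of smooth Lipschitz functions vanishing outside `Ω`, which is
locally eventually equal to `1` in `Ω`. -/
lemma exists_contDiff_exhaustion {Ω : Set C₀(Γ, ℝ)} (hΩ : IsOpen Ω) :
    ∃ χ : ℕ → C₀(Γ, ℝ) → ℝ, ∃ L : ℕ → ℝ≥0, (∀ n, ContDiff ℝ ∞ (χ n)) ∧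
      (∀ n, LipschitzWith (L n) (χ n)) ∧ (∀ x, χ 0 x = 0) ∧ (∀ n x, χ n x ≤ χ (n + 1) x) ∧
      (∀ n x, χ n x ≤ 1) ∧ (∀ n, ∀ x ∉ Ω, χ n x = 0) ∧
      ∀ x ∈ Ω, ∃ N, ∀ᶠ y in 𝓝 x, ∀ n, N ≤ n → χ n y = 1 := by
  rcases Ωᶜ.eq_empty_or_nonempty with he | hne
  · have hu : Ω = univ := compl_empty_iff.1 he
    refine ⟨fun n _ => if n = 0 then 0 else 1, fun _ => 0, fun n => contDiff_const,
      fun n => LipschitzWith.const _, fun x => rfl, fun n x => ?_, fun n x => ?_,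
      fun n x hx => absurd (hu ▸ mem_univ x) hx, fun x _ => ⟨1, Eventually.of_forall fun y n hn => ?_⟩⟩
    · dsimp only
      split_ifs <;> simp_all
    · dsimp only
      split_ifs <;> simp
    · simp [Nat.one_le_iff_ne_zero.1 hn]
  · choose χ L hs hL h0 h1 hone hzero using fun n : ℕ =>
      exists_contDiff_cutoff Ωᶜ (b := (1 / 2) ^ n) (by positivity)
    refine ⟨fun n => n.casesOn 0 χ, fun n => n.casesOn 0 L, ?_, ?_, fun x => rfl, ?_, ?_, ?_, ?_⟩
    · rintro (_ | n)
      exacts [contDiff_const, hs n]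
    · rintro (_ | n)
      exacts [LipschitzWith.const _, hL n]
    · rintro (_ | n) x
      · exact h0 0 x
      · change χ n x ≤ χ (n + 1) x
        rcases le_total (infDist x Ωᶜ) ((1 / 2) ^ n / 2) with h | h
        · rw [hzero n x h]
          exact h0 _ _
        · rw [hone (n + 1) x (by rw [pow_succ]; linarith)]
          exact h1 _ _
    · rintro (_ | n) x
      exacts [zero_le_one, h1 n x]
    · rintro (_ | n) x hx
      · rfl
      · refine hzero n x ?_
        rw [infDist_zero_of_mem (show x ∈ Ωᶜ from hx)]
        positivity
    · intro x hx
      have hpos : 0 < infDist x Ωᶜ :=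
        (hΩ.isClosed_compl.notMem_iff_infDist_pos hne).1 (by simpa using hx)
      obtain ⟨N, hN⟩ := exists_pow_lt_of_lt_one hpos (by norm_num : (1 / 2 : ℝ) < 1)
      refine ⟨N + 1, ?_⟩
      filter_upwards [(continuous_infDist_pt Ωᶜ).continuousAt.eventually (lt_mem_nhds hN)] with y hy
      rintro (_ | n) hn
      · omega
      · refine hone n y (le_trans ?_ hy.le)
        exact pow_le_pow_of_le_one (by norm_num) (by norm_num) (by omega)

/-- A Lipschitz function can be made smooth on an open set, without changing it outside this set,
at the cost of an arbitrarily small increase of its Lipschitz constant. -/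
lemma exists_contDiffOn_eqOn_compl {Ω : Set C₀(Γ, ℝ)} (hΩ : IsOpen Ω) {K K' : ℝ≥0} (hK : K < K')
    {w : C₀(Γ, ℝ) → ℝ} (hw : LipschitzWith K w) :
    ∃ V : C₀(Γ, ℝ) → ℝ, LipschitzWith K' V ∧ ContDiffOn ℝ ∞ V Ω ∧ ∀ x ∉ Ω, V x = w x := by
  obtain ⟨χ, L, hs, hL, h0, hmono, h1, hzero, hone⟩ := exists_contDiff_exhaustion hΩ
  obtain ⟨η, hη, hηK⟩ : ∃ η : ℝ, 0 < η ∧ (K : ℝ) + η = K' :=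
    ⟨K' - K, sub_pos.2 (by exact_mod_cast hK), by ring⟩
  choose v hvs hvK hvw using fun n : ℕ => exists_contDiff_approx hw
    (ε := η * (1 / 2) ^ (n + 1) / (L (n + 1) + L n + 1)) (by positivity)
  let V : ℕ → C₀(Γ, ℝ) → ℝ := fun N x =>
    w x + ∑ n ∈ Finset.range N, (χ (n + 1) x - χ n x) * (v n x - w x)
  have hVlim : ∀ x, ∃ N, ∀ M, N ≤ M → V M x = V N x := by
    intro x
    obtain ⟨N, hN⟩ : ∃ N, ∀ n, N ≤ n → χ (n + 1) x - χ n x = 0 := by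
      by_cases hx : x ∈ Ω
      · obtain ⟨N, hN⟩ := hone x hx
        exact ⟨N, fun n hn => by
          rw [hN.self_of_nhds n hn, hN.self_of_nhds (n + 1) (by omega), sub_self]⟩
      · exact ⟨0, fun n _ => by rw [hzero _ x hx, hzero _ x hx, sub_self]⟩
    refine ⟨N, fun M hM => ?_⟩
    induction M, hM using Nat.le_induction with
    | base => rfl
    | succ M hM ih =>
      rw [← ih]
      simp only [V, Finset.sum_range_succ, hN M hM, zero_mul, add_zero]
  choose N hN using hVlim
  have hV : ∀ x M, N x ≤ M → V (N x) x = V M x := fun x M hM => (hN x M hM).symm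
  have hlip : ∀ x y M, |V M x - V M y - (1 - χ M x) * (w x - w y)| ≤
      (χ M x * K + η * (1 - (1 / 2) ^ M)) * dist x y := by
    intro x y M
    induction M with
    | zero => simp [V, h0]
    | succ M ih =>
      have e1 : |(χ (M + 1) x - χ M x) * (v M x - v M y)| ≤
          (χ (M + 1) x - χ M x) * (K * dist x y) := by
        rw [abs_mul, abs_of_nonneg (sub_nonneg.2 (hmono M x))]
        exact mul_le_mul_of_nonneg_left ((hvK M).dist_le_mul x y) (sub_nonneg.2 (hmono M x))
      have e2 : |((χ (M + 1) x - χ M x) - (χ (M + 1) y - χ M y)) * (v M y - w y)| ≤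
          η * (1 / 2) ^ (M + 1) * dist x y := by
        have a1 := (hL (M + 1)).dist_le_mul x y
        have a2 := (hL M).dist_le_mul x y
        have a3 : |(χ (M + 1) x - χ M x) - (χ (M + 1) y - χ M y)| ≤
            (L (M + 1) + L M + 1) * dist x y := by
          rw [Real.dist_eq, abs_le] at a1 a2
          have := dist_nonneg (x := x) (y := y)
          rw [abs_le]
          constructor <;> linarith
        rw [abs_mul]
        refine (mul_le_mul a3 (hvw M y) (abs_nonneg _) (by positivity)).trans_eq ?_
        field_simp
      have e3 : V (M + 1) x - V (M + 1) y - (1 - χ (M + 1) x) * (w x - w y) =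
          (V M x - V M y - (1 - χ M x) * (w x - w y)) +
            (χ (M + 1) x - χ M x) * (v M x - v M y) +
            ((χ (M + 1) x - χ M x) - (χ (M + 1) y - χ M y)) * (v M y - w y) := by
        simp only [V, Finset.sum_range_succ]
        ring
      rw [e3]
      refine ((abs_add_three _ _ _).trans (add_le_add (add_le_add ih e1) e2)).trans_eq ?_
      ring
  refine ⟨fun x => V (N x) x, ?_, ?_, ?_⟩
  · refine LipschitzWith.of_dist_le_mul fun x y => ?_
    rw [hV x (max (N x) (N y)) (le_max_left _ _), hV y (max (N x) (N y)) (le_max_right _ _)]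
    set M := max (N x) (N y)
    have b1 := hlip x y M
    have b2 : |(1 - χ M x) * (w x - w y)| ≤ (1 - χ M x) * (K * dist x y) := by
      rw [abs_mul, abs_of_nonneg (sub_nonneg.2 (h1 M x))]
      exact mul_le_mul_of_nonneg_left (hw.dist_le_mul x y) (sub_nonneg.2 (h1 M x))
    have b3 : 0 ≤ η * (1 / 2) ^ M * dist x y := by positivity
    rw [← hηK, Real.dist_eq]
    calc |V M x - V M y| = |(V M x - V M y - (1 - χ M x) * (w x - w y)) +
          (1 - χ M x) * (w x - w y)| := by rw [sub_add_cancel]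
      _ ≤ _ := (abs_add_le _ _).trans (add_le_add b1 b2)
      _ ≤ (K + η) * dist x y := by linarith
  · intro x hx
    obtain ⟨M, hM⟩ := hone x hx
    have hsm : ContDiff ℝ ∞ fun y =>
        ∑ n ∈ Finset.range M, (χ (n + 1) y - χ n y) * v n y :=
      ContDiff.sum fun n _ => ((hs (n + 1)).sub (hs n)).mul (hvs n)
    refine (hsm.contDiffAt.congr_of_eventuallyEq ?_).contDiffWithinAt
    filter_upwards [hM] with y hy
    have hstab : ∀ n, M ≤ n → V n y = V M y := by
      intro n hn
      induction n, hn using Nat.le_induction with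
      | base => rfl
      | succ n hn ih =>
        rw [← ih]
        simp only [V, Finset.sum_range_succ, hy n hn, hy (n + 1) (by omega), sub_self, zero_mul,
          add_zero]
    rw [hV y (max (N y) M) (le_max_left _ _), hstab _ (le_max_right _ _)]
    simp only [V, mul_sub]
    rw [Finset.sum_sub_distrib, ← Finset.sum_mul, Finset.sum_range_sub (fun n => χ n y), hy M le_rfl,
      h0]
    ring
  · intro x hx
    simp [V, hzero _ x hx]

end ZeroAtInftyContinuousMap

lemma isLipschitzWithOn_lipOn {X : Type*} [PseudoMetricSpace X] {f : X → ℝ} {s : Set X}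
    (h : ∃ K, IsLipschitzWithOn K f s) : IsLipschitzWithOn (lipOn f s) f s := by
  obtain ⟨K, hK⟩ := h
  intro x hx y hy
  have hne : {L : ℝ | 0 < L ∧ ∀ x ∈ s, ∀ y ∈ s, |f x - f y| ≤ L * dist x y}.Nonempty :=
    ⟨|K| + 1, by positivity, fun x hx y hy => (hK x hx y hy).trans <| by
      gcongr
      linarith [le_abs_self K]⟩
  rcases (dist_nonneg (x := x) (y := y)).eq_or_lt with h0 | hpos
  · obtain ⟨L, -, hL⟩ := hne
    have := hL x hx y hy
    rw [← h0] at this ⊢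
    simpa using this
  · rw [← div_le_iff₀ hpos]
    exact le_csInf hne fun L hL => (div_le_iff₀ hpos).2 (hL.2 x hx y hy)

lemma IsLipschitzWithOn.exists_lipschitzWith {X : Type*} [PseudoMetricSpace X] {f : X → ℝ}
    {s : Set X} {K : ℝ≥0} (h : IsLipschitzWithOn K f s) :
    ∃ g : X → ℝ, LipschitzWith K g ∧ EqOn f g s :=
  (LipschitzOnWith.of_dist_le_mul fun x hx y hy => h x hx y hy).extend_real

lemma lipOn_nonneg {X : Type*} [PseudoMetricSpace X] (f : X → ℝ) (s : Set X) : 0 ≤ lipOn f s :=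
  Real.sInf_nonneg fun _ hL => hL.1.le

lemma lipOn_le {X : Type*} [PseudoMetricSpace X] {f : X → ℝ} {s : Set X} {K : ℝ} (hK : 0 < K)
    (h : IsLipschitzWithOn K f s) : lipOn f s ≤ K :=
  csInf_le ⟨0, fun _ hL => hL.1.le⟩ ⟨hK, h⟩

end SmoothApproximation

/-- Approximation of Lipschitz functions preserving boundary values and the Lipschitz
constant, by functions of class `C^∞`, in the space `c₀(Γ)` (here realized as the
zero-at-infinity continuous maps `C₀(Γ, ℝ)` on the discrete space `Γ`, with the sup norm). -/
theorem stmt_2 (Γ : Type*) [TopologicalSpace Γ] [DiscreteTopology Γ]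
    (Ω : Set C₀(Γ, ℝ)) (hΩ : IsOpen Ω) (u₀ : C₀(Γ, ℝ) → ℝ)
    (hu₀ : ∃ K : ℝ, IsLipschitzWithOn K u₀ (closure Ω))
    (hlt : lipOn u₀ (frontier Ω) < lipOn u₀ (closure Ω))
    (ε : ℝ) (hε : 0 < ε) :
    ∃ v : C₀(Γ, ℝ) → ℝ,
      ContDiffOn ℝ (⊤ : ℕ∞) v Ω ∧
      IsLipschitzWithOn (lipOn u₀ (closure Ω)) v (closure Ω) ∧
      lipOn v (closure Ω) ≤ lipOn u₀ (closure Ω) ∧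
      (∀ x ∈ frontier Ω, v x = u₀ x) ∧
      (∀ x ∈ closure Ω, |u₀ x - v x| ≤ ε) := by
  set k := lipOn u₀ (closure Ω)
  have hu : IsLipschitzWithOn k u₀ (closure Ω) := isLipschitzWithOn_lipOn hu₀
  have hufr : IsLipschitzWithOn (lipOn u₀ (frontier Ω)) u₀ (frontier Ω) :=
    isLipschitzWithOn_lipOn ⟨k, fun x hx y hy =>
      hu x (frontier_subset_closure hx) y (frontier_subset_closure hy)⟩
  have hkpos : 0 < k := (lipOn_nonneg u₀ (frontier Ω)).trans_lt hlt
  obtain ⟨K, hKk⟩ : ∃ K : NNReal, (K : ℝ) = k := ⟨⟨k, hkpos.le⟩, rfl⟩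
  obtain ⟨K₁, hK₁⟩ : ∃ K₁ : NNReal, (K₁ : ℝ) = lipOn u₀ (frontier Ω) :=
    ⟨⟨_, lipOn_nonneg u₀ (frontier Ω)⟩, rfl⟩
  obtain ⟨u, huK, hueq⟩ := IsLipschitzWithOn.exists_lipschitzWith (hKk ▸ hu)
  obtain ⟨w, hwK, hweq⟩ := IsLipschitzWithOn.exists_lipschitzWith (hK₁ ▸ hufr)
  have hlt' : K₁ < K := by
    rw [← NNReal.coe_lt_coe, hK₁, hKk]
    exact hlt
  obtain ⟨A, hAs, hAK, hA⟩ := ZeroAtInftyContinuousMap.exists_contDiff_approx huK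
    (ε := ε / 3) (by positivity)
  obtain ⟨V, hVK, hVs, hV⟩ := ZeroAtInftyContinuousMap.exists_contDiffOn_eqOn_compl hΩ hlt' hwK
  obtain ⟨v, hvK, hvs, hvA, hvV⟩ := exists_contDiffOn_clamp hAK hVK hAs.contDiffOn hVs
    (ε := ε / 3) (η := ε / 3) (by positivity) (by positivity)
  have hvk : IsLipschitzWithOn k v (closure Ω) := fun x _ y _ => hKk ▸ hvK.dist_le_mul x y
  refine ⟨v, hvs, hvk, lipOn_le hkpos hvk, fun x hx => ?_, fun x hx => ?_⟩
  · have hVx : V x = u₀ x := by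
      rw [hV x fun h => (hΩ.frontier_eq ▸ hx).2 h, hweq hx]
    rw [hvV x, hVx]
    rw [hVx, hueq (frontier_subset_closure hx), abs_sub_comm]
    exact hA x
  · rw [hueq hx]
    have h1 := abs_le.1 (hA x)
    have h2 := abs_le.1 (hvA x)
    rw [abs_le]
    constructor <;> linarith
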